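/- arXiv:2307.01720 — 2 statements merged into one kernel-verified Lean document; each statement's English description precedes it below -/
import Mathlib

section
/- Let n and m be positive integers, let A, B, C be nonzero complex numbers, and let h(z) = A·z^(n+m) + B·conj(z)^m + C. Let r > 0 and θ ∈ (0, 2π) be real numbers with sin((n+2m)·θ/2) ≠ 0, and suppose h(r) = 0 and h(r·e^(iθ)) = 0. Then A = −(C / r^(n+m)) · (e^(i·m·θ) − 1)/(e^(i·(n+2m)·θ) − 1), B = −(C / r^m) · e^(i·m·θ)·(e^(i·(n+m)·θ) − 1)/(e^(i·(n+2m)·θ) − 1), and A^m · B^(n+m) / C^(n+2m) = (−1)^n · r^(−2m(n+m)) · sin^m(m·θ/2) · sin^(n+m)((n+m)·θ/2) / sin^(n+2m)((n+2m)·θ/2). In particular A^m · B^(n+m) / C^(n+2m) is a real number. -/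
open Complex

/-- The harmonic trinomial `z ↦ A z^(n+m) + B (conj z)^m + C`. -/
noncomputable def trin (n m : ℕ) (A B C : ℂ) : ℂ → ℂ :=
  fun z => A * z ^ (n + m) + B * (starRingEnd ℂ z) ^ m + C

/-- Egerváry equivalence of the harmonic trinomials with coefficients
`A₁, B₁, C₁` and `A₂, B₂, C₂`. -/
noncomputable def EgervaryEquiv (n m : ℕ) (A₁ B₁ C₁ A₂ B₂ C₂ : ℂ) : Prop :=
  ∃ c : ℂ, c ≠ 0 ∧ ∃ δ : ℝ,
    (∀ z : ℂ, trin n m A₁ B₁ C₁ z =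
        c * trin n m A₂ B₂ C₂ (Complex.exp (Complex.I * δ) * z)) ∨
    (∀ z : ℂ, trin n m A₁ B₁ C₁ z =
        c * trin n m (starRingEnd ℂ A₂) (starRingEnd ℂ B₂) (starRingEnd ℂ C₂)
          (Complex.exp (Complex.I * δ) * z))

theorem exp_mul_sub_one_eq_sin_mul_pow (k : ℕ) (θ : ℝ) :
    exp (I * (((k : ℝ) * θ : ℝ) : ℂ)) - 1 =
      2 * I * (Real.sin ((k : ℝ) * θ / 2) : ℂ) * exp (I * (θ / 2 : ℂ)) ^ k := by
  have hpow : exp (I * (θ / 2 : ℂ)) ^ k = exp ((k : ℂ) * θ / 2 * I) := by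
    rw [← Complex.exp_nat_mul]
    ring_nf
  have hsq : exp (I * (((k : ℝ) * θ : ℝ) : ℂ)) =
      exp ((k : ℂ) * θ / 2 * I) * exp ((k : ℂ) * θ / 2 * I) := by
    rw [← Complex.exp_add]
    push_cast
    ring_nf
  have hinv : exp (-((k : ℂ) * θ / 2) * I) * exp ((k : ℂ) * θ / 2 * I) = 1 := by
    rw [← Complex.exp_add, neg_mul, neg_add_cancel, Complex.exp_zero]
  rw [hpow, hsq]
  push_cast
  rw [Complex.sin]
  linear_combination (-I ^ 2) * hinv +
    (1 - exp ((k : ℂ) * θ / 2 * I) ^ 2) * (-I_sq)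

/-- Explicit form of the coefficients of a harmonic trinomial having the two roots
`r` and `r e^{iθ}` on the same circle, and the resulting value of
`A^m B^(n+m) / C^(n+2m)`, which is in particular real. -/
theorem stmt_5 (n m : ℕ) (hn : 0 < n) (hm : 0 < m)
    (A B C : ℂ) (hA : A ≠ 0) (hB : B ≠ 0) (hC : C ≠ 0)
    (r θ : ℝ) (hr : 0 < r) (hθ : 0 < θ ∧ θ < 2 * Real.pi)
    (hsin : Real.sin (((n : ℝ) + 2 * m) * θ / 2) ≠ 0)
    (h₁ : trin n m A B C (r : ℂ) = 0)
    (h₂ : trin n m A B C ((r : ℂ) * Complex.exp (Complex.I * θ)) = 0) :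
    A = -(C / (r : ℂ) ^ (n + m)) *
        ((Complex.exp (Complex.I * (((m : ℝ) * θ : ℝ) : ℂ)) - 1) /
          (Complex.exp (Complex.I * ((((n : ℝ) + 2 * m) * θ : ℝ) : ℂ)) - 1)) ∧
    B = -(C / (r : ℂ) ^ m) *
        (Complex.exp (Complex.I * (((m : ℝ) * θ : ℝ) : ℂ)) *
            (Complex.exp (Complex.I * ((((n : ℝ) + m) * θ : ℝ) : ℂ)) - 1) /
          (Complex.exp (Complex.I * ((((n : ℝ) + 2 * m) * θ : ℝ) : ℂ)) - 1)) ∧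
    A ^ m * B ^ (n + m) / C ^ (n + 2 * m) =
      ((((-1 : ℝ) ^ n / r ^ (2 * m * (n + m))) *
          ((Real.sin ((m : ℝ) * θ / 2)) ^ m *
            (Real.sin (((n : ℝ) + m) * θ / 2)) ^ (n + m) /
              (Real.sin (((n : ℝ) + 2 * m) * θ / 2)) ^ (n + 2 * m)) : ℝ) : ℂ) ∧
    ∃ t : ℝ, A ^ m * B ^ (n + m) / C ^ (n + 2 * m) = (t : ℂ) := by
  have hr0 : (r : ℂ) ≠ 0 := ofReal_ne_zero.mpr hr.ne'
  have hM := exp_mul_sub_one_eq_sin_mul_pow m θ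
  have hNM := exp_mul_sub_one_eq_sin_mul_pow (n + m) θ
  have hN2M := exp_mul_sub_one_eq_sin_mul_pow (n + 2 * m) θ
  have hw (k : ℕ) : exp (I * (((k : ℝ) * θ : ℝ) : ℂ)) = exp (I * θ) ^ k := by
    rw [← Complex.exp_nat_mul]
    push_cast
    ring_nf
  have hw_sq : exp (I * θ) = exp (I * (θ / 2 : ℂ)) ^ 2 := by
    rw [← Complex.exp_nat_mul]
    push_cast
    ring_nf
  have hconj : (starRingEnd ℂ) (exp (I * θ)) * exp (I * θ) = 1 := by
    rw [← exp_conj, ← Complex.exp_add]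
    simp
  have hcast : (n : ℝ) + m = ((n + m : ℕ) : ℝ) := by push_cast; rfl
  have hcast' : (n : ℝ) + 2 * m = ((n + 2 * m : ℕ) : ℝ) := by push_cast; rfl
  rw [hcast'] at hsin
  rw [hcast, hcast']
  have hu : exp (I * (θ / 2 : ℂ)) ≠ 0 := Complex.exp_ne_zero _
  have hs : (Real.sin (((n + 2 * m : ℕ) : ℝ) * θ / 2) : ℂ) ≠ 0 := ofReal_ne_zero.mpr hsin
  have hD : exp (I * ((((n + 2 * m : ℕ) : ℝ) * θ : ℝ) : ℂ)) - 1 ≠ 0 := by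
    rw [hN2M]
    exact mul_ne_zero (mul_ne_zero (mul_ne_zero two_ne_zero I_ne_zero) hs) (pow_ne_zero _ hu)
  have e₁ : A * (r : ℂ) ^ (n + m) + B * (r : ℂ) ^ m + C = 0 := by
    simpa [trin] using h₁
  have e₂ : A * (r : ℂ) ^ (n + m) * exp (I * θ) ^ (n + 2 * m) + B * (r : ℂ) ^ m +
      C * exp (I * θ) ^ m = 0 := by
    have hpow : (starRingEnd ℂ) (exp (I * θ)) ^ m * exp (I * θ) ^ m = 1 := by
      rw [← mul_pow, hconj, one_pow]
    have h := h₂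
    simp only [trin, map_mul, conj_ofReal, mul_pow] at h
    linear_combination exp (I * θ) ^ m * h - B * (r : ℂ) ^ m * hpow
  have hAeq : A = -(C / (r : ℂ) ^ (n + m)) *
      ((exp (I * (((m : ℝ) * θ : ℝ) : ℂ)) - 1) /
        (exp (I * ((((n + 2 * m : ℕ) : ℝ) * θ : ℝ) : ℂ)) - 1)) := by
    have hr' := pow_ne_zero (n + m) hr0
    rw [neg_mul, div_mul_div_comm, ← neg_div, eq_div_iff (mul_ne_zero hr' hD), hw, hw]
    linear_combination e₂ - e₁
  have hBeq : B = -(C / (r : ℂ) ^ m) *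
      (exp (I * (((m : ℝ) * θ : ℝ) : ℂ)) *
          (exp (I * ((((n + m : ℕ) : ℝ) * θ : ℝ) : ℂ)) - 1) /
        (exp (I * ((((n + 2 * m : ℕ) : ℝ) * θ : ℝ) : ℂ)) - 1)) := by
    have hr' := pow_ne_zero m hr0
    rw [neg_mul, div_mul_div_comm, ← neg_div, eq_div_iff (mul_ne_zero hr' hD), hw, hw, hw]
    linear_combination exp (I * θ) ^ (n + 2 * m) * e₁ - e₂
  have hval : A ^ m * B ^ (n + m) / C ^ (n + 2 * m) =
      ((((-1 : ℝ) ^ n / r ^ (2 * m * (n + m))) *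
          ((Real.sin ((m : ℝ) * θ / 2)) ^ m *
            (Real.sin (((n + m : ℕ) : ℝ) * θ / 2)) ^ (n + m) /
              (Real.sin (((n + 2 * m : ℕ) : ℝ) * θ / 2)) ^ (n + 2 * m)) : ℝ) : ℂ) := by
    rw [hAeq, hBeq, hM, hNM, hN2M, hw, hw_sq]
    rw [ofReal_mul, ofReal_div, ofReal_div, ofReal_mul, ofReal_pow, ofReal_pow, ofReal_pow,
      ofReal_pow, ofReal_pow, ofReal_neg, ofReal_one]
    generalize (Real.sin (((n + 2 * m : ℕ) : ℝ) * θ / 2) : ℂ) = s₃ at hs ⊢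
    generalize (Real.sin (((n + m : ℕ) : ℝ) * θ / 2) : ℂ) = s₂
    generalize (Real.sin ((m : ℝ) * θ / 2) : ℂ) = s₁
    generalize exp (I * (θ / 2 : ℂ)) = u at hu ⊢
    generalize (r : ℂ) = ρ at hr0 ⊢
    have hA' : -(C / ρ ^ (n + m)) * (2 * I * s₁ * u ^ m / (2 * I * s₃ * u ^ (n + 2 * m))) =
        -1 * C * s₁ * u ^ m / (ρ ^ (n + m) * s₃ * u ^ (n + 2 * m)) := by
      field_simp
    have hB' : -(C / ρ ^ m) * ((u ^ 2) ^ m * (2 * I * s₂ * u ^ (n + m)) /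
        (2 * I * s₃ * u ^ (n + 2 * m))) =
        -1 * C * s₂ * u ^ (n + 3 * m) / (ρ ^ m * s₃ * u ^ (n + 2 * m)) := by
      field_simp
      ring
    have hsign : (-1 : ℂ) ^ m * (-1) ^ (n + m) = (-1) ^ n := by
      rw [pow_add, mul_left_comm, ← mul_pow, neg_one_mul, neg_neg, one_pow, mul_one]
    rw [hA', hB', div_pow, div_pow, div_mul_div_comm, div_div, div_mul_div_comm,
      div_eq_div_iff (by simp [hr0, hs, hu, hC]) (by simp [hr0, hs]), ← hsign]
    ring
  exact ⟨hAeq, hBeq, hval, _, hval⟩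
end

section
/- Let n and m be positive integers, let A, B, C be nonzero complex numbers, and let r > 0 be a real number such that A·r^(n+m) + B·r^m + C = 0 and (n+m)·A·r^(n+m−1) + m·B·r^(m−1) = 0 (i.e., r is a root of multiplicity at least two of the trinomial x ↦ A·x^(n+m) + B·x^m + C). Then A = m·C/(n·r^(n+m)), B = −(n+m)·C/(n·r^m), and A^m · B^(n+m) / C^(n+2m) = (−1)^(n+m) · m^m · (n+m)^(n+m) / (r^(2m(n+m)) · n^(n+2m)). In particular this quantity is real, and the harmonic trinomial h(z) = A·z^(n+m) + B·conj(z)^m + C is Egerváry equivalent to a harmonic trinomial whose coefficients are nonzero real numbers. -/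
open Complex

/-- A harmonic trinomial with a root `r > 0` of multiplicity at least two: explicit
coefficients, the value of `A^m B^(n+m) / C^(n+2m)` (which is real), and Egerváry
equivalence to a harmonic trinomial with real coefficients. -/
theorem stmt_6 (n m : ℕ) (hn : 0 < n) (hm : 0 < m)
    (A B C : ℂ) (hA : A ≠ 0) (hB : B ≠ 0) (hC : C ≠ 0)
    (r : ℝ) (hr : 0 < r)
    (h₁ : A * (r : ℂ) ^ (n + m) + B * (r : ℂ) ^ m + C = 0)
    (h₂ : ((n : ℂ) + m) * A * (r : ℂ) ^ (n + m - 1) + (m : ℂ) * B * (r : ℂ) ^ (m - 1) = 0) :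
    A = (m : ℂ) * C / ((n : ℂ) * (r : ℂ) ^ (n + m)) ∧
    B = -(((n : ℂ) + m) * C) / ((n : ℂ) * (r : ℂ) ^ m) ∧
    A ^ m * B ^ (n + m) / C ^ (n + 2 * m) =
      ((((-1 : ℝ) ^ (n + m) * (m : ℝ) ^ m * ((n : ℝ) + m) ^ (n + m) /
          (r ^ (2 * m * (n + m)) * (n : ℝ) ^ (n + 2 * m))) : ℝ) : ℂ) ∧
    (∃ t : ℝ, A ^ m * B ^ (n + m) / C ^ (n + 2 * m) = (t : ℂ)) ∧
    (∃ A' B' C' : ℝ, A' ≠ 0 ∧ B' ≠ 0 ∧ C' ≠ 0 ∧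
        EgervaryEquiv n m A B C (A' : ℂ) (B' : ℂ) (C' : ℂ)) := by
  have hn' : (n : ℂ) ≠ 0 := by exact_mod_cast hn.ne'
  have hr' : (r : ℂ) ≠ 0 := by exact_mod_cast hr.ne'
  have h₃ : ((n : ℂ) + m) * (A * (r : ℂ) ^ (n + m)) + (m : ℂ) * (B * (r : ℂ) ^ m) = 0 := by
    have e₁ : (r : ℂ) ^ (n + m) = (r : ℂ) ^ (n + m - 1) * r := (pow_sub_one_mul (by omega) _).symm
    have e₂ : (r : ℂ) ^ m = (r : ℂ) ^ (m - 1) * r := (pow_sub_one_mul (by omega) _).symm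
    rw [e₁, e₂]
    linear_combination (r : ℂ) * h₂
  have hA' : A = (m : ℂ) * C / ((n : ℂ) * (r : ℂ) ^ (n + m)) := by
    rw [eq_div_iff (by positivity)]
    linear_combination h₃ - (m : ℂ) * h₁
  have hB' : B = -(((n : ℂ) + m) * C) / ((n : ℂ) * (r : ℂ) ^ m) := by
    rw [eq_div_iff (by positivity)]
    linear_combination ((n : ℂ) + m) * h₁ - h₃
  have hq : A ^ m * B ^ (n + m) / C ^ (n + 2 * m) =
      ((((-1 : ℝ) ^ (n + m) * (m : ℝ) ^ m * ((n : ℝ) + m) ^ (n + m) /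
          (r ^ (2 * m * (n + m)) * (n : ℝ) ^ (n + 2 * m))) : ℝ) : ℂ) := by
    push_cast
    rw [hA', hB', neg_eq_neg_one_mul, div_pow, div_pow, div_mul_div_comm, div_div,
      div_eq_div_iff (by positivity) (by positivity)]
    simp only [mul_pow, ← pow_mul]
    ring
  refine ⟨hA', hB', hq, ⟨_, hq⟩, m / (n * r ^ (n + m)), -(n + m) / (n * r ^ m), 1,
    by positivity, ?_, one_ne_zero, C, hC, 0, Or.inl fun z => ?_⟩
  · rw [neg_div, neg_ne_zero]
    positivity
  · simp only [trin]
    rw [hA', hB']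
    push_cast
    rw [mul_zero, Complex.exp_zero, one_mul]
    ring
end
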